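/- arXiv:1712.07731 — 3 statements merged into one kernel-verified Lean document; each statement's English description precedes it below -/
import Mathlib

section
/- Let p > 0, s > 0, K ⊆ ℝ⁺ a p-convex interval with 0 ∈ K, and h_s(x) = x^s. If f is operator (p,h_s)-convex on K, then the inequality f([α A^p + β B^p]^{1/p}) ≤ α^s f(A) + β^s f(B) holds for all positive semidefinite matrices A, B with spectra in K and all α, β > 0 with α + β ≤ 1 if and only if f(0) = 0. -/
open Matrix
open scoped ComplexOrder

/-- The matrix `A` raised to the real power `p`, defined via the continuous
functional calculus (using the real power function `Real.rpow`). -/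
noncomputable def mpow {n : ℕ} (A : Matrix (Fin n) (Fin n) ℂ) (p : ℝ) :
    Matrix (Fin n) (Fin n) ℂ :=
  cfc (fun x : ℝ => x ^ p) A

/-- The Loewner order on matrices: `loewnerLE X Y` iff `Y - X` is positive semidefinite. -/
def loewnerLE {n : ℕ} (X Y : Matrix (Fin n) (Fin n) ℂ) : Prop :=
  (Y - X).PosSemidef

/-- A set `K ⊆ ℝ` is `p`-convex if `(l*x^p + (1-l)*y^p)^(1/p) ∈ K` for all
`x, y ∈ K` and `l ∈ [0,1]`. -/
def PConvex (p : ℝ) (K : Set ℝ) : Prop :=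
  ∀ x ∈ K, ∀ y ∈ K, ∀ l ∈ Set.Icc (0 : ℝ) 1,
    (l * x ^ p + (1 - l) * y ^ p) ^ (1 / p) ∈ K

/-- `h` is super-multiplicative on `J`: `h (x*y) ≥ h x * h y` for all `x, y ∈ J`. -/
def SuperMultiplicativeOn (J : Set ℝ) (h : ℝ → ℝ) : Prop :=
  ∀ x ∈ J, ∀ y ∈ J, h x * h y ≤ h (x * y)

/-- `f` is operator `(p,h)`-convex on `K`: `f` is nonnegative and continuous on `K`, and
`f([α A^p + (1-α) B^p]^{1/p}) ≤ h(α) f(A) + h(1-α) f(B)` (in the Loewner order) for all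
positive semidefinite matrices `A, B` (of any order `n`) with spectra in `K` and all
`α ∈ (0,1)`, where matrix functions are taken via the continuous functional calculus. -/
def OperatorPHConvexOn (p : ℝ) (K : Set ℝ) (h : ℝ → ℝ) (f : ℝ → ℝ) : Prop :=
  (∀ x ∈ K, 0 ≤ f x) ∧ ContinuousOn f K ∧
  ∀ (n : ℕ) (A B : Matrix (Fin n) (Fin n) ℂ),
    A.PosSemidef → B.PosSemidef → spectrum ℝ A ⊆ K → spectrum ℝ B ⊆ K →
    ∀ α ∈ Set.Ioo (0 : ℝ) 1,
      loewnerLE (cfc f (mpow (α • mpow A p + (1 - α) • mpow B p) (1 / p)))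
        (h α • cfc f A + h (1 - α) • cfc f B)

section MatrixPower

open scoped MatrixOrder

variable {n : ℕ} {A M : Matrix (Fin n) (Fin n) ℂ}

theorem Matrix.PosSemidef.nonneg_of_mem_spectrum_real (hA : A.PosSemidef) {x : ℝ}
    (hx : x ∈ spectrum ℝ A) : 0 ≤ x :=
  spectrum_nonneg_of_nonneg hA.nonneg hx

theorem posSemidef_mpow (hA : A.PosSemidef) (p : ℝ) : (mpow A p).PosSemidef :=
  Matrix.nonneg_iff_posSemidef.mp <| cfc_nonneg fun _ hx =>
    Real.rpow_nonneg (hA.nonneg_of_mem_spectrum_real hx) p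

theorem mpow_zero {p : ℝ} (hp : p ≠ 0) : mpow (0 : Matrix (Fin n) (Fin n) ℂ) p = 0 := by
  simp [mpow, Real.zero_rpow hp]

theorem spectrum_mpow (hA : A.PosSemidef) (p : ℝ) :
    spectrum ℝ (mpow A p) = (fun x : ℝ => x ^ p) '' spectrum ℝ A :=
  cfc_map_spectrum (R := ℝ) _ A hA.isHermitian (A.finite_real_spectrum.continuousOn _)

theorem mpow_one_div_mpow (hM : M.PosSemidef) {p : ℝ} (hp : p ≠ 0) :
    mpow (mpow M (1 / p)) p = M := by
  refine (cfc_comp' (R := ℝ) (fun x : ℝ => x ^ p) (fun x : ℝ => x ^ (1 / p)) M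
    ((M.finite_real_spectrum.image _).continuousOn _) (M.finite_real_spectrum.continuousOn _)
    hM.isHermitian).symm.trans ?_
  refine Eq.trans ?_ (cfc_id' ℝ M hM.isHermitian)
  refine cfc_congr fun x hx => ?_
  have h0 := hM.nonneg_of_mem_spectrum_real hx
  simp only [← Real.rpow_mul h0, one_div_mul_cancel hp, Real.rpow_one]

theorem mpow_le_algebraMap (hA : A.PosSemidef) {p m : ℝ} (hp : 0 ≤ p)
    (hm : ∀ x ∈ spectrum ℝ A, x ≤ m) :
    mpow A p ≤ algebraMap ℝ (Matrix (Fin n) (Fin n) ℂ) (m ^ p) :=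
  cfc_le_algebraMap _ _ _ (fun x hx =>
    Real.rpow_le_rpow (hA.nonneg_of_mem_spectrum_real hx) (hm x hx) hp)
    (A.finite_real_spectrum.continuousOn _) hA.isHermitian

theorem posSemidef_convexCombination_mpow {A B : Matrix (Fin n) (Fin n) ℂ} (hA : A.PosSemidef)
    (hB : B.PosSemidef) (p : ℝ) {a b : ℝ} (ha : 0 ≤ a) (hb : 0 ≤ b) :
    (a • mpow A p + b • mpow B p).PosSemidef :=
  ((posSemidef_mpow hA p).smul ha).add ((posSemidef_mpow hB p).smul hb)

/-- The `p`-power mean of two positive semidefinite matrices with spectra in an interval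
`K ⊆ [0, ∞)` containing `0` has spectrum in `K`. -/
theorem spectrum_powerMean_subset {A B : Matrix (Fin n) (Fin n) ℂ} (hA : A.PosSemidef)
    (hB : B.PosSemidef) {p : ℝ} (hp : 0 < p) {K : Set ℝ} (hK : K.OrdConnected)
    (h0K : (0 : ℝ) ∈ K) (hAK : spectrum ℝ A ⊆ K) (hBK : spectrum ℝ B ⊆ K) {a b : ℝ}
    (ha : 0 ≤ a) (hb : 0 ≤ b) (hab : a + b = 1) :
    spectrum ℝ (mpow (a • mpow A p + b • mpow B p) (1 / p)) ⊆ K := by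
  obtain ⟨m, hmS, hm⟩ := Set.exists_max_image (insert 0 (spectrum ℝ A ∪ spectrum ℝ B)) id
    ((A.finite_real_spectrum.union B.finite_real_spectrum).insert 0) ⟨0, Set.mem_insert _ _⟩
  have hmK : m ∈ K := Set.insert_subset h0K (Set.union_subset hAK hBK) hmS
  have hm0 : 0 ≤ m := hm 0 (Set.mem_insert _ _)
  have hM := posSemidef_convexCombination_mpow hA hB p ha hb
  have hle : a • mpow A p + b • mpow B p ≤
      algebraMap ℝ (Matrix (Fin n) (Fin n) ℂ) (m ^ p) := by
    have hA' := mpow_le_algebraMap (m := m) hA hp.le fun x hx => hm x (Or.inr (Or.inl hx))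
    have hB' := mpow_le_algebraMap (m := m) hB hp.le fun x hx => hm x (Or.inr (Or.inr hx))
    rw [Matrix.le_iff] at hA' hB' ⊢
    have h := (hA'.smul ha).add (hB'.smul hb)
    have e : algebraMap ℝ (Matrix (Fin n) (Fin n) ℂ) (m ^ p) =
        a • algebraMap ℝ (Matrix (Fin n) (Fin n) ℂ) (m ^ p) +
          b • algebraMap ℝ (Matrix (Fin n) (Fin n) ℂ) (m ^ p) := by
      rw [← add_smul, hab, one_smul]
    rw [e]
    convert h using 1
    module
  rw [spectrum_mpow hM]
  rintro _ ⟨x, hx, rfl⟩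
  have hx0 := hM.nonneg_of_mem_spectrum_real hx
  have hxm := (le_algebraMap_iff_spectrum_le (R := ℝ) hM.isHermitian).mp hle x hx
  refine hK.out h0K hmK ⟨Real.rpow_nonneg hx0 _, ?_⟩
  calc x ^ (1 / p) ≤ (m ^ p) ^ (1 / p) := Real.rpow_le_rpow hx0 hxm (by positivity)
    _ = m := by rw [← Real.rpow_mul hm0, mul_one_div_cancel hp.ne', Real.rpow_one]

end MatrixPower

theorem loewnerLE.trans {n : ℕ} {X Y Z : Matrix (Fin n) (Fin n) ℂ} (hXY : loewnerLE X Y)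
    (hYZ : loewnerLE Y Z) : loewnerLE X Z := by
  have h := Matrix.PosSemidef.add hXY hYZ
  rwa [add_comm, sub_add_sub_cancel] at h

theorem loewnerLE.smul {n : ℕ} {X Y : Matrix (Fin n) (Fin n) ℂ} (hXY : loewnerLE X Y) {c : ℝ}
    (hc : 0 ≤ c) : loewnerLE (c • X) (c • Y) := by
  have h := Matrix.PosSemidef.smul hXY hc
  rwa [smul_sub] at h

/-- For `h_s(x) = x^s` and `f` operator `(p,h_s)`-convex on `K` (with `0 ∈ K`), the
inequality `f([α A^p + β B^p]^{1/p}) ≤ α^s f(A) + β^s f(B)` holds for all positive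
semidefinite `A, B` with spectra in `K` and all `α, β > 0` with `α + β ≤ 1` if and only
if `f(0) = 0`. -/
theorem stmt6 (p s : ℝ) (hp : 0 < p) (hs : 0 < s)
    (K : Set ℝ) (hK : K ⊆ Set.Ici 0) (hKI : K.OrdConnected)
    (hKp : PConvex p K) (h0K : (0 : ℝ) ∈ K)
    (f : ℝ → ℝ) (hf : OperatorPHConvexOn p K (fun x : ℝ => x ^ s) f) :
    (∀ (n : ℕ) (A B : Matrix (Fin n) (Fin n) ℂ), A.PosSemidef → B.PosSemidef →
      spectrum ℝ A ⊆ K → spectrum ℝ B ⊆ K →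
      ∀ α β : ℝ, 0 < α → 0 < β → α + β ≤ 1 →
        loewnerLE (cfc f (mpow (α • mpow A p + β • mpow B p) (1 / p)))
          (α ^ s • cfc f A + β ^ s • cfc f B))
    ↔ f 0 = 0 := by
  constructor
  · intro H
    have hsp : spectrum ℝ (0 : Matrix (Fin 1) (Fin 1) ℂ) ⊆ K := by
      rw [spectrum.zero_eq]
      exact Set.singleton_subset_iff.mpr h0K
    obtain ⟨α, ⟨hα0, hα⟩, hαs⟩ : ∃ α : ℝ, (0 < α ∧ α ≤ 1 / 2) ∧ α ^ s ≤ 1 / 4 := by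
      refine ⟨min (1 / 2) ((1 / 4) ^ (1 / s)), ⟨by positivity, min_le_left _ _⟩, ?_⟩
      calc (min (1 / 2) ((1 / 4) ^ (1 / s)) : ℝ) ^ s ≤ ((1 / 4) ^ (1 / s)) ^ s :=
            Real.rpow_le_rpow (by positivity) (min_le_right _ _) hs.le
        _ = 1 / 4 := by
            rw [← Real.rpow_mul (by norm_num), one_div_mul_cancel hs.ne', Real.rpow_one]
    have h := H 1 0 0 .zero .zero hsp hsp α α hα0 hα0 (by linarith)
    have hre : f 0 ≤ α ^ s * f 0 + α ^ s * f 0 := by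
      have hd := h.diag_nonneg (i := 0)
      simp only [mpow_zero hp.ne', mpow_zero (one_div_pos.mpr hp).ne', smul_zero, add_zero,
        cfc_apply_zero, Matrix.sub_apply, Matrix.add_apply, Matrix.smul_apply,
        Matrix.algebraMap_matrix_apply, if_true] at hd
      have hd' := (Complex.le_def.mp hd).1
      simp at hd'
      linarith
    nlinarith [hf.1 0 h0K]
  · intro hf0 n A B hA hB hAK hBK α β hα hβ hαβ
    obtain ⟨-, -, hconv⟩ := hf
    set θ := α + β with hθ
    have hθ0 : 0 < θ := add_pos hα hβ
    have hsum : 1 - α / θ = β / θ := by field_simp; linarith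
    have hα1 : α / θ ∈ Set.Ioo (0 : ℝ) 1 :=
      ⟨div_pos hα hθ0, by rw [div_lt_one hθ0]; linarith⟩
    set M := (α / θ) • mpow A p + (β / θ) • mpow B p with hMdef
    have hM : M.PosSemidef :=
      posSemidef_convexCombination_mpow hA hB p (div_pos hα hθ0).le (div_pos hβ hθ0).le
    have hθM : α • mpow A p + β • mpow B p = θ • M := by
      rw [hMdef, smul_add, smul_smul, smul_smul, mul_div_cancel₀ _ hθ0.ne',
        mul_div_cancel₀ _ hθ0.ne']
    have hAB := hconv n A B hA hB hAK hBK _ hα1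
    simp only [hsum] at hAB
    rw [← hMdef] at hAB
    have hscale : loewnerLE (cfc f (mpow (θ • M) (1 / p))) (θ ^ s • cfc f (mpow M (1 / p))) := by
      rcases hαβ.eq_or_lt with h1 | h1
      · simp [h1, loewnerLE, Matrix.PosSemidef.zero]
      · have hsp0 : spectrum ℝ (0 : Matrix (Fin n) (Fin n) ℂ) ⊆ K := by
          rw [← map_zero (algebraMap ℝ (Matrix (Fin n) (Fin n) ℂ))]
          exact (CFC.spectrum_algebraMap_subset (p := IsSelfAdjoint) 0).trans
            (Set.singleton_subset_iff.mpr h0K)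
        have h := hconv n (mpow M (1 / p)) 0 (posSemidef_mpow hM _) .zero
          (spectrum_powerMean_subset hA hB hp hKI h0K hAK hBK (div_pos hα hθ0).le
            (div_pos hβ hθ0).le (by rw [← hsum]; ring)) hsp0 θ ⟨hθ0, h1⟩
        simpa [-one_div, mpow_one_div_mpow hM hp.ne', mpow_zero hp.ne', hf0] using h
    rw [hθM]
    refine hscale.trans ?_
    have h := hAB.smul (Real.rpow_nonneg hθ0.le s)
    rwa [smul_add, smul_smul, smul_smul, ← Real.mul_rpow hθ0.le (div_pos hα hθ0).le,
      ← Real.mul_rpow hθ0.le (div_pos hβ hθ0).le, mul_div_cancel₀ _ hθ0.ne',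
      mul_div_cancel₀ _ hθ0.ne'] at h
end

section
/- Let p > 0, K ⊆ ℝ⁺ a p-convex interval with 0 ∈ K, f a nonnegative continuous function on K with f(0) = 0, and h a nonnegative non-zero super-multiplicative function on an interval J ⊆ ℝ⁺ containing (0,1) satisfying 2 h(1/2) ≤ h(α)/α for all α ∈ (0,1). If for every orthogonal projection Q and every positive semidefinite matrix A with spectrum in K one has f((Q A^p Q)^{1/p}) ≤ 2 h(1/2) Q f(A) Q, then f is operator (p,h)-convex on K. -/
open Matrix
open scoped ComplexOrder

/-- The functional calculus respects intertwiners between Hermitian matrices. -/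
theorem cfc_mul_eq_mul_cfc_of_intertwine {m n : ℕ} (f : ℝ → ℝ) {A : Matrix (Fin m) (Fin m) ℂ}
    {B : Matrix (Fin n) (Fin n) ℂ} (hA : IsSelfAdjoint A) (hB : IsSelfAdjoint B)
    {V : Matrix (Fin m) (Fin n) ℂ} (hV : A * V = V * B) :
    cfc f A * V = V * cfc f B := by
  classical
  let s : Finset ℝ := A.finite_real_spectrum.toFinset ∪ B.finite_real_spectrum.toFinset
  let q : Polynomial ℝ := Lagrange.interpolate s id f
  have hq : ∀ x ∈ s, f x = q.eval x := fun x hx =>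
    (Lagrange.eval_interpolate_at_node f (Function.injective_id.injOn) hx).symm
  have hcfcA : cfc f A = Polynomial.aeval A q := by
    rw [← cfc_polynomial q A]
    exact cfc_congr fun x hx => hq x (by simp [s, hx])
  have hcfcB : cfc f B = Polynomial.aeval B q := by
    rw [← cfc_polynomial q B]
    exact cfc_congr fun x hx => hq x (by simp [s, hx])
  have hpow : ∀ k : ℕ, A ^ k * V = V * B ^ k := by
    intro k
    induction k with
    | zero => simp
    | succ k ih => rw [pow_succ, pow_succ, Matrix.mul_assoc, hV, ← Matrix.mul_assoc, ih,
        Matrix.mul_assoc]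
  rw [hcfcA, hcfcB, Polynomial.aeval_eq_sum_range, Polynomial.aeval_eq_sum_range,
    Matrix.sum_mul, Matrix.mul_sum]
  exact Finset.sum_congr rfl fun k _ => by rw [Matrix.smul_mul, Matrix.mul_smul, hpow]

/-- `S` and `T` are isometries with orthogonal ranges which together span the whole space. -/
structure IsIsometryPair {m n : ℕ} (S T : Matrix (Fin m) (Fin n) ℂ) : Prop where
  left_isometry : Sᴴ * S = 1
  right_isometry : Tᴴ * T = 1
  left_right : Sᴴ * T = 0
  right_left : Tᴴ * S = 0
  complete : S * Sᴴ + T * Tᴴ = 1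

theorem exists_isIsometryPair (n : ℕ) :
    ∃ S T : Matrix (Fin (n + n)) (Fin n) ℂ, IsIsometryPair S T := by
  let S₀ : Matrix (Fin n ⊕ Fin n) (Fin n) ℂ := fromRows 1 0
  let T₀ : Matrix (Fin n ⊕ Fin n) (Fin n) ℂ := fromRows 0 1
  refine ⟨S₀.submatrix finSumFinEquiv.symm id, T₀.submatrix finSumFinEquiv.symm id, ?_⟩
  constructor <;>
    simp only [S₀, T₀, conjTranspose_submatrix, submatrix_mul_equiv]
  · simp [conjTranspose_fromRows_eq_fromCols_conjTranspose, fromCols_mul_fromRows]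
  · simp [conjTranspose_fromRows_eq_fromCols_conjTranspose, fromCols_mul_fromRows]
  · simp [conjTranspose_fromRows_eq_fromCols_conjTranspose, fromCols_mul_fromRows]
  · simp [conjTranspose_fromRows_eq_fromCols_conjTranspose, fromCols_mul_fromRows]
  · rw [← submatrix_mul _ _ _ id _ Function.bijective_id,
      ← submatrix_mul _ _ _ id _ Function.bijective_id]
    have hone : S₀ * S₀ᴴ + T₀ * T₀ᴴ = 1 := by
      simp only [S₀, T₀, conjTranspose_fromRows_eq_fromCols_conjTranspose, fromRows_mul_fromCols,
        fromBlocks_add]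
      simp
    change (S₀ * S₀ᴴ + T₀ * T₀ᴴ).submatrix _ _ = 1
    rw [hone, submatrix_one_equiv]

namespace IsIsometryPair

variable {m n : ℕ} {S T : Matrix (Fin m) (Fin n) ℂ}

theorem rotate (hST : IsIsometryPair S T) {a b : ℝ} (hab : a * a + b * b = 1) :
    IsIsometryPair (a • S + b • T) (b • S - a • T) := by
  have hba : b * b + a * a = 1 := by rw [add_comm, hab]
  constructor
  · simp [Matrix.add_mul, Matrix.mul_add, hST.left_isometry, hST.right_isometry, hST.left_right,
      hST.right_left, smul_smul, ← add_smul, hab]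
  · simp [Matrix.sub_mul, Matrix.mul_sub, hST.left_isometry, hST.right_isometry, hST.left_right,
      hST.right_left, smul_smul, ← add_smul, hba]
  · simp [Matrix.add_mul, Matrix.mul_sub, hST.left_isometry, hST.right_isometry, hST.left_right,
      hST.right_left, smul_smul, mul_comm]
  · simp [Matrix.sub_mul, Matrix.mul_add, hST.left_isometry, hST.right_isometry, hST.left_right,
      hST.right_left, smul_smul, mul_comm]
  · have key : (a • S + b • T) * (a • S + b • T)ᴴ + (b • S - a • T) * (b • S - a • T)ᴴ
        = (a * a + b * b) • (S * Sᴴ + T * Tᴴ) := by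
      simp only [conjTranspose_add, conjTranspose_sub, conjTranspose_smul, star_trivial,
        Matrix.add_mul, Matrix.mul_add, Matrix.sub_mul, Matrix.mul_sub, Matrix.smul_mul,
        Matrix.mul_smul]
      module
    rw [key, hab, one_smul, hST.complete]

variable {A B : Matrix (Fin n) (Fin n) ℂ}

theorem directSum_mul_left (hST : IsIsometryPair S T) :
    (S * A * Sᴴ + T * B * Tᴴ) * S = S * A := by
  simp [Matrix.add_mul, Matrix.mul_assoc, hST.left_isometry, hST.right_left]

theorem directSum_mul_right (hST : IsIsometryPair S T) :
    (S * A * Sᴴ + T * B * Tᴴ) * T = T * B := by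
  simp [Matrix.add_mul, Matrix.mul_assoc, hST.right_isometry, hST.left_right]

theorem directSum_mul_directSum (hST : IsIsometryPair S T) (C D : Matrix (Fin n) (Fin n) ℂ) :
    (S * A * Sᴴ + T * B * Tᴴ) * (S * C * Sᴴ + T * D * Tᴴ)
      = S * (A * C) * Sᴴ + T * (B * D) * Tᴴ := by
  rw [Matrix.mul_add, Matrix.mul_assoc S C, ← Matrix.mul_assoc _ S, hST.directSum_mul_left,
    Matrix.mul_assoc T D, ← Matrix.mul_assoc _ T, hST.directSum_mul_right]
  simp only [Matrix.mul_assoc]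

theorem posSemidef_directSum (hA : A.PosSemidef) (hB : B.PosSemidef) :
    (S * A * Sᴴ + T * B * Tᴴ).PosSemidef :=
  (hA.mul_mul_conjTranspose_same S).add (hB.mul_mul_conjTranspose_same T)

theorem cfc_directSum (hST : IsIsometryPair S T) (hA : A.PosSemidef) (hB : B.PosSemidef)
    (f : ℝ → ℝ) :
    cfc f (S * A * Sᴴ + T * B * Tᴴ) = S * cfc f A * Sᴴ + T * cfc f B * Tᴴ := by
  have hX : IsSelfAdjoint (S * A * Sᴴ + T * B * Tᴴ) := (posSemidef_directSum hA hB).isHermitian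
  have hS := cfc_mul_eq_mul_cfc_of_intertwine f hX hA.isHermitian hST.directSum_mul_left
  have hT := cfc_mul_eq_mul_cfc_of_intertwine f hX hB.isHermitian hST.directSum_mul_right
  rw [← hS, ← hT, Matrix.mul_assoc _ S Sᴴ, Matrix.mul_assoc _ T Tᴴ, ← Matrix.mul_add,
    hST.complete, Matrix.mul_one]

theorem spectrum_directSum_subset (hST : IsIsometryPair S T) :
    spectrum ℝ (S * A * Sᴴ + T * B * Tᴴ) ⊆ spectrum ℝ A ∪ spectrum ℝ B := by
  intro x hx
  by_contra hAB
  rw [Set.mem_union, not_or, spectrum.notMem_iff, spectrum.notMem_iff, isUnit_iff_exists,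
    isUnit_iff_exists] at hAB
  obtain ⟨⟨u, hu, hu'⟩, ⟨v, hv, hv'⟩⟩ := hAB
  have hsub : algebraMap ℝ (Matrix (Fin m) (Fin m) ℂ) x - (S * A * Sᴴ + T * B * Tᴴ)
      = S * (algebraMap ℝ (Matrix (Fin n) (Fin n) ℂ) x - A) * Sᴴ
        + T * (algebraMap ℝ (Matrix (Fin n) (Fin n) ℂ) x - B) * Tᴴ := by
    rw [Algebra.algebraMap_eq_smul_one, Algebra.algebraMap_eq_smul_one,
      ← hST.complete]
    simp only [Matrix.mul_sub, Matrix.sub_mul, Matrix.mul_smul, Matrix.smul_mul, Matrix.mul_one]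
    module
  refine hx ?_
  rw [spectrum.mem_resolventSet_iff, hsub, isUnit_iff_exists]
  refine ⟨S * u * Sᴴ + T * v * Tᴴ, ?_, ?_⟩
  · rw [hST.directSum_mul_directSum, hu, hv, Matrix.mul_one, Matrix.mul_one, hST.complete]
  · rw [hST.directSum_mul_directSum, hu', hv', Matrix.mul_one, Matrix.mul_one, hST.complete]

end IsIsometryPair

open scoped MatrixOrder in
theorem posSemidef_cfc {n : ℕ} {f : ℝ → ℝ} {A : Matrix (Fin n) (Fin n) ℂ}
    (hf : ∀ x ∈ spectrum ℝ A, 0 ≤ f x) : (cfc f A).PosSemidef :=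
  nonneg_iff_posSemidef.mp (cfc_nonneg hf)

/-- If for every orthogonal projection `Q` and every positive semidefinite `A` with
spectrum in `K` one has `f((Q A^p Q)^{1/p}) ≤ 2 h(1/2) Q f(A) Q`, then `f` is operator
`(p,h)`-convex on `K`. -/
theorem stmt13 (p : ℝ) (hp : 0 < p) (K : Set ℝ) (hK : K ⊆ Set.Ici 0) (hKI : K.OrdConnected)
    (hKp : PConvex p K) (h0K : (0 : ℝ) ∈ K)
    (J : Set ℝ) (hJ : Set.Ioo (0 : ℝ) 1 ⊆ J) (hJpos : J ⊆ Set.Ici 0)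
    (h : ℝ → ℝ) (hh0 : ∀ x ∈ J, 0 ≤ h x) (hhne : ∃ x ∈ J, h x ≠ 0)
    (hsm : SuperMultiplicativeOn J h)
    (h2h : ∀ α ∈ Set.Ioo (0 : ℝ) 1, 2 * h (1 / 2) ≤ h α / α)
    (f : ℝ → ℝ) (hfnn : ∀ x ∈ K, 0 ≤ f x) (hfc : ContinuousOn f K) (hf0 : f 0 = 0)
    (hproj : ∀ (n : ℕ) (Q A : Matrix (Fin n) (Fin n) ℂ), Qᴴ = Q → Q * Q = Q →
      A.PosSemidef → spectrum ℝ A ⊆ K →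
      loewnerLE (cfc f (mpow (Q * mpow A p * Q) (1 / p)))
        ((2 * h (1 / 2)) • (Q * cfc f A * Q))) :
    OperatorPHConvexOn p K h f := by
  refine ⟨hfnn, hfc, fun n A B hA hB hAK hBK α hα => ?_⟩
  obtain ⟨S, T, hST⟩ := exists_isIsometryPair n
  have hα' : 1 - α ∈ Set.Ioo (0 : ℝ) 1 := ⟨by linarith [hα.2], by linarith [hα.1]⟩
  have ha : √α * √α = α := Real.mul_self_sqrt hα.1.le
  have hb : √(1 - α) * √(1 - α) = 1 - α := Real.mul_self_sqrt hα'.1.le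
  have hUV := hST.rotate (a := √α) (b := √(1 - α)) (by rw [ha, hb]; ring)
  set U := √α • S + √(1 - α) • T with hU
  set V := √(1 - α) • S - √α • T with hV
  have hSU : Sᴴ * U = √α • 1 := by
    simp [hU, Matrix.mul_add, hST.left_isometry, hST.left_right]
  have hSV : Sᴴ * V = √(1 - α) • 1 := by
    simp [hV, Matrix.mul_sub, hST.left_isometry, hST.left_right]
  have hUS : Uᴴ * S = √α • 1 := by simpa using congrArg conjTranspose hSU
  have hVS : Vᴴ * S = √(1 - α) • 1 := by simpa using congrArg conjTranspose hSV
  have compress (C D : Matrix (Fin n) (Fin n) ℂ) :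
      Sᴴ * (U * C * Uᴴ + V * D * Vᴴ) * S = α • C + (1 - α) • D := by
    calc Sᴴ * (U * C * Uᴴ + V * D * Vᴴ) * S
        = (Sᴴ * U) * C * (Uᴴ * S) + (Sᴴ * V) * D * (Vᴴ * S) := by
          simp only [Matrix.mul_add, Matrix.add_mul, Matrix.mul_assoc]
      _ = α • C + (1 - α) • D := by
          rw [hSU, hSV, hUS, hVS]
          simp [smul_smul, ha, hb]
  have hXK := hUV.spectrum_directSum_subset.trans (Set.union_subset hAK hBK)
  have hproj' := (hproj _ (S * Sᴴ) _ (by simp)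
    (by rw [Matrix.mul_assoc, ← Matrix.mul_assoc Sᴴ, hST.left_isometry, Matrix.one_mul])
    (IsIsometryPair.posSemidef_directSum hA hB) hXK).conjTranspose_mul_mul_same S
  simp only [mpow, hUV.cfc_directSum hA hB] at hproj'
  set C := α • mpow A p + (1 - α) • mpow B p with hC
  have hCsa : IsSelfAdjoint C :=
    ((IsSelfAdjoint.all α).smul (cfc_predicate _ A)).add
      ((IsSelfAdjoint.all (1 - α)).smul (cfc_predicate _ B))
  have hcomp (M : Matrix (Fin (n + n)) (Fin (n + n)) ℂ) :
      S * Sᴴ * M * (S * Sᴴ) = S * (Sᴴ * M * S) * Sᴴ := by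
    simp only [Matrix.mul_assoc]
  have hcancel (M : Matrix (Fin n) (Fin n) ℂ) : S * M * Sᴴ * S = S * M := by
    rw [Matrix.mul_assoc, hST.left_isometry, Matrix.mul_one]
  have hYsa : IsSelfAdjoint (S * C * Sᴴ) :=
    isHermitian_mul_mul_conjTranspose S hCsa
  have hroot := cfc_mul_eq_mul_cfc_of_intertwine (fun x : ℝ => x ^ (1 / p)) hYsa hCsa (hcancel C)
  have hf := cfc_mul_eq_mul_cfc_of_intertwine f (cfc_predicate _ _) (cfc_predicate _ _) hroot
  have hlow : 2 * h (1 / 2) * α ≤ h α := (le_div_iff₀ hα.1).mp (h2h α hα)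
  have hlow' : 2 * h (1 / 2) * (1 - α) ≤ h (1 - α) := (le_div_iff₀ hα'.1).mp (h2h _ hα')
  have hfA : (cfc f A).PosSemidef := posSemidef_cfc fun x hx => hfnn x (hAK hx)
  have hfB : (cfc f B).PosSemidef := posSemidef_cfc fun x hx => hfnn x (hBK hx)
  rw [hcomp, hcomp, compress, compress, Matrix.mul_sub, Matrix.sub_mul,
    Matrix.mul_assoc Sᴴ (cfc f _) S] at hproj'
  erw [hf] at hproj'
  rw [← Matrix.mul_assoc Sᴴ S, hST.left_isometry, Matrix.one_mul, Matrix.mul_smul Sᴴ,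
    Matrix.smul_mul, Matrix.mul_assoc Sᴴ, hcancel, ← Matrix.mul_assoc Sᴴ S, hST.left_isometry,
    Matrix.one_mul] at hproj'
  have hsum := (hproj'.add (hfA.smul (sub_nonneg.mpr hlow))).add
    (hfB.smul (sub_nonneg.mpr hlow'))
  unfold loewnerLE
  convert hsum using 1
  simp only [mpow]
  module
end

section
/- (Choi–Davis–Jensen type inequality) Let p > 0, f an operator (p,h)-convex function on ℝ⁺ with f(0) = 0, and h a nonnegative non-zero super-multiplicative function on an interval J ⊆ ℝ⁺ containing (0,1) satisfying 2 h(1/2) ≤ h(α)/α for all α ∈ (0,1). Let Φ be a unital positive linear map between matrix algebras (i.e. Φ is linear, Φ(I) = I, and Φ maps positive semidefinite matrices to positive semidefinite matrices). Then for every positive semidefinite matrix A, f((Φ(A^p))^{1/p}) ≤ 2 h(1/2) Φ(f(A)). -/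
open Matrix
open scoped ComplexOrder

namespace Matrix

open Polynomial in
/-- The real functional calculus of Hermitian matrices respects intertwining relations. -/
theorem IsHermitian.cfc_mul_eq_mul_cfc {ι κ : Type*} [Fintype ι] [DecidableEq ι] [Fintype κ]
    [DecidableEq κ] {Y : Matrix ι ι ℂ} {Z : Matrix κ κ ℂ} (hY : Y.IsHermitian)
    (hZ : Z.IsHermitian) {C : Matrix ι κ ℂ} (hC : Y * C = C * Z) (f : ℝ → ℝ) :
    cfc f Y * C = C * cfc f Z := by
  have hpoly (q : ℝ[X]) : aeval Y q * C = C * aeval Z q := by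
    induction q using Polynomial.induction_on' with
    | add q r hq hr => simp [Matrix.add_mul, Matrix.mul_add, hq, hr]
    | monomial k a =>
      have hpow : Y ^ k * C = C * Z ^ k := by
        induction k with
        | zero => simp
        | succ k ih =>
          rw [pow_succ, Matrix.mul_assoc, hC, ← Matrix.mul_assoc, ih, Matrix.mul_assoc, ← pow_succ]
      simp [aeval_monomial, Algebra.algebraMap_eq_smul_one, hpow]
  let S := (Y.finite_real_spectrum.union Z.finite_real_spectrum).toFinset
  let q := Lagrange.interpolate S id f
  have hq {x : ℝ} (hx : x ∈ S) : f x = q.eval x :=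
    (Lagrange.eval_interpolate_at_node f Function.injective_id.injOn hx).symm
  rw [cfc_congr (f := f) (g := q.eval) (a := Y) fun x hx ↦ hq (by simp [S, hx]),
    cfc_congr (f := f) (g := q.eval) (a := Z) fun x hx ↦ hq (by simp [S, hx]),
    cfc_polynomial q Y hY.isSelfAdjoint, cfc_polynomial q Z hZ.isSelfAdjoint, hpoly]

theorem isHermitian_diagonal_ofReal {ι : Type*} [DecidableEq ι] (d : ι → ℝ) :
    (diagonal fun i ↦ (d i : ℂ)).IsHermitian :=
  isHermitian_diagonal_of_self_adjoint _ (by ext i; simp)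

theorem cfc_diagonal_ofReal {ι : Type*} [Fintype ι] [DecidableEq ι] (d : ι → ℝ) (f : ℝ → ℝ) :
    cfc f (diagonal fun i ↦ (d i : ℂ)) = diagonal fun i ↦ (f (d i) : ℂ) := by
  ext i j
  let e : Matrix ι (Fin 1) ℂ := of fun k _ ↦ if k = j then 1 else 0
  have hZ : (algebraMap ℝ (Matrix (Fin 1) (Fin 1) ℂ) (d j)).IsHermitian :=
    IsSelfAdjoint.algebraMap _ (IsSelfAdjoint.all _)
  have h := (isHermitian_diagonal_ofReal d).cfc_mul_eq_mul_cfc hZ (C := e) (by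
    ext k l
    by_cases hk : k = j <;>
      simp [e, diagonal_mul, Algebra.algebraMap_eq_smul_one, hk]) f
  rw [cfc_algebraMap] at h
  have hij := congrFun (congrFun h i) 0
  by_cases hk : i = j <;>
    simpa [e, Matrix.mul_apply, Algebra.algebraMap_eq_smul_one, hk, diagonal_apply] using hij

/-- Spectral resolution of a Hermitian matrix, compatible with the functional calculus. -/
theorem IsHermitian.exists_cfc_eq_sum_smul {n : ℕ} {A : Matrix (Fin n) (Fin n) ℂ}
    (hA : A.IsHermitian) :
    ∃ P : Fin n → Matrix (Fin n) (Fin n) ℂ, (∀ i, (P i).PosSemidef) ∧ ∑ i, P i = 1 ∧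
      ∀ g : ℝ → ℝ, cfc g A = ∑ i, (g (hA.eigenvalues i) : ℂ) • P i := by
  let U : Matrix (Fin n) (Fin n) ℂ := hA.eigenvectorUnitary
  have hsum (c : Fin n → ℂ) :
      ∑ i, c i • (U * diagonal (Pi.single i 1) * Uᴴ) = U * diagonal c * Uᴴ := by
    simp_rw [Matrix.mul_assoc, ← Matrix.mul_smul U, ← Matrix.smul_mul, ← Matrix.mul_assoc]
    rw [← Matrix.sum_mul, ← Matrix.mul_sum]
    congr 2
    ext i j
    by_cases hij : i = j <;> simp [Matrix.sum_apply, Pi.single_apply, hij]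
  refine ⟨fun i ↦ U * diagonal (Pi.single i 1) * Uᴴ, fun i ↦ ?_, ?_, fun g ↦ ?_⟩
  · refine (PosSemidef.diagonal fun j ↦ ?_).mul_mul_conjTranspose_same U
    by_cases hij : j = i <;> simp [hij]
  · have hU : U * Uᴴ = 1 := Unitary.coe_mul_star_self hA.eigenvectorUnitary
    simpa [hU] using hsum 1
  · rw [hsum, hA.cfc_eq]
    rfl

open scoped MatrixOrder in
/-- A finite family of positive semidefinite matrices is the compression of a diagonal family of
mutually orthogonal projections. -/
theorem exists_conjTranspose_mul_diagonal_mul_eq_sum {n m : ℕ}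
    {E : Fin n → Matrix (Fin m) (Fin m) ℂ} (hE : ∀ i, (E i).PosSemidef) :
    ∃ C : Matrix (Fin (n * m)) (Fin m) ℂ, ∀ c : Fin n → ℂ,
      Cᴴ * diagonal (fun a : Fin (n * m) ↦ c (finProdFinEquiv.symm a).1) * C = ∑ i, c i • E i := by
  choose B hB using fun i ↦ CStarAlgebra.nonneg_iff_eq_star_mul_self.mp (hE i).nonneg
  refine ⟨of fun a j ↦ B (finProdFinEquiv.symm a).1 (finProdFinEquiv.symm a).2 j, fun c ↦ ?_⟩
  ext j k
  rw [Matrix.mul_apply, ← finProdFinEquiv.sum_comp, Fintype.sum_prod_type, Matrix.sum_apply]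
  refine Finset.sum_congr rfl fun i _ ↦ ?_
  simp only [mul_diagonal, conjTranspose_apply, of_apply, Equiv.symm_apply_apply, smul_apply,
    hB i, star_eq_conjTranspose]
  rw [Matrix.mul_apply, Finset.smul_sum]
  simp only [conjTranspose_apply, smul_eq_mul]
  exact Finset.sum_congr rfl fun x _ ↦ by ring

theorem PosSemidef.spectrum_subset_Ici {n : ℕ} {A : Matrix (Fin n) (Fin n) ℂ}
    (hA : A.PosSemidef) : spectrum ℝ A ⊆ Set.Ici 0 := by
  rw [hA.isHermitian.spectrum_real_eq_range_eigenvalues]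
  rintro _ ⟨i, rfl⟩
  exact hA.eigenvalues_nonneg i

end Matrix

theorem mpow_isHermitian {n : ℕ} (A : Matrix (Fin n) (Fin n) ℂ) (p : ℝ) :
    (mpow A p).IsHermitian :=
  cfc_predicate _ A

/-- Jensen's inequality for the compression of a positive semidefinite matrix by an isometry. -/
theorem OperatorPHConvexOn.compression_le {p : ℝ} {h f : ℝ → ℝ}
    (hf : OperatorPHConvexOn p (Set.Ici 0) h f) {N m : ℕ} {D : Matrix (Fin N) (Fin N) ℂ}
    (hD : D.PosSemidef) {C : Matrix (Fin N) (Fin m) ℂ} (hC : Cᴴ * C = 1) :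
    loewnerLE (cfc f (mpow (Cᴴ * mpow D p * C) (1 / p)))
      ((2 * h (1 / 2)) • (Cᴴ * cfc f D * C)) := by
  let W : Matrix (Fin N) (Fin N) ℂ := (2 : ℝ) • (C * Cᴴ) - 1
  have hWC : W * C = C := by
    simp only [W, Matrix.sub_mul, Matrix.smul_mul, Matrix.mul_assoc, hC, Matrix.mul_one,
      Matrix.one_mul]
    module
  have hWh : Wᴴ = W := by simp [W]
  have hCW : Cᴴ * W = Cᴴ := by simpa [hWh] using congrArg conjTranspose hWC
  have hWW : W * W = 1 := by
    have : W * (C * Cᴴ) = C * Cᴴ := by rw [← Matrix.mul_assoc, hWC]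
    nth_rw 2 [show W = (2 : ℝ) • (C * Cᴴ) - 1 from rfl]
    rw [Matrix.mul_sub, Matrix.mul_smul, this, Matrix.mul_one]
    simp [W]
  have hB : (W * D * W).PosSemidef := by
    simpa [hWh] using hD.mul_mul_conjTranspose_same W
  have hBcfc (g : ℝ → ℝ) : cfc g (W * D * W) = W * cfc g D * W := by
    rw [← hB.isHermitian.cfc_mul_eq_mul_cfc hD.isHermitian (C := W)
      (by simp only [Matrix.mul_assoc, hWW, Matrix.mul_one]),
      Matrix.mul_assoc (cfc g _) W W, hWW, Matrix.mul_one]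
  have key := hf.2.2 N D (W * D * W) hD hB hD.spectrum_subset_Ici hB.spectrum_subset_Ici
    (1 / 2) (by norm_num)
  set Y := (1 / 2 : ℝ) • mpow D p + (1 - 1 / 2 : ℝ) • mpow (W * D * W) p with hYdef
  have hY : Y.IsHermitian :=
    ((mpow_isHermitian D p).smul (IsSelfAdjoint.all _)).add
      ((mpow_isHermitian _ p).smul (IsSelfAdjoint.all _))
  have hZ : (Cᴴ * mpow D p * C).IsHermitian :=
    isHermitian_conjTranspose_mul_mul C (mpow_isHermitian D p)
  have hYC : Y * C = C * (Cᴴ * mpow D p * C) := by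
    have hWp : mpow (W * D * W) p = W * mpow D p * W := hBcfc _
    rw [hYdef, hWp, Matrix.add_mul, Matrix.smul_mul, Matrix.smul_mul, Matrix.mul_assoc _ W C, hWC]
    simp only [W, Matrix.sub_mul, Matrix.smul_mul, Matrix.one_mul, Matrix.mul_assoc]
    module
  have hroot : mpow Y (1 / p) * C = C * mpow (Cᴴ * mpow D p * C) (1 / p) :=
    hY.cfc_mul_eq_mul_cfc hZ hYC _
  have hcomp := (mpow_isHermitian Y (1 / p)).cfc_mul_eq_mul_cfc (mpow_isHermitian _ _) hroot f
  have hCWC : Cᴴ * (W * cfc f D * W) * C = Cᴴ * cfc f D * C := by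
    rw [← Matrix.mul_assoc, ← Matrix.mul_assoc, hCW, Matrix.mul_assoc _ W C, hWC]
  have hres := PosSemidef.conjTranspose_mul_mul_same key C
  rw [Matrix.mul_sub, Matrix.sub_mul, Matrix.mul_assoc Cᴴ (cfc f _) C, hcomp, ← Matrix.mul_assoc,
    hC, Matrix.one_mul, hBcfc, Matrix.mul_add, Matrix.add_mul, Matrix.mul_smul, Matrix.mul_smul,
    Matrix.smul_mul, Matrix.smul_mul, hCWC, ← add_smul] at hres
  rw [loewnerLE]
  convert hres using 3
  norm_num [two_mul]

/-- Choi–Davis–Jensen type inequality: if `f` is operator `(p,h)`-convex on `ℝ⁺` with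
`f(0) = 0` and `Φ` is a unital positive linear map between matrix algebras, then for
every positive semidefinite `A`, `f((Φ(A^p))^{1/p}) ≤ 2 h(1/2) Φ(f(A))`. -/
theorem stmt16 (p : ℝ) (hp : 0 < p)
    (J : Set ℝ) (hJ : Set.Ioo (0 : ℝ) 1 ⊆ J) (hJpos : J ⊆ Set.Ici 0)
    (h : ℝ → ℝ) (hh0 : ∀ x ∈ J, 0 ≤ h x) (hhne : ∃ x ∈ J, h x ≠ 0)
    (hsm : SuperMultiplicativeOn J h)
    (h2h : ∀ α ∈ Set.Ioo (0 : ℝ) 1, 2 * h (1 / 2) ≤ h α / α)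
    (f : ℝ → ℝ) (hf : OperatorPHConvexOn p (Set.Ici 0) h f) (hf0 : f 0 = 0)
    (n m : ℕ) (Φ : Matrix (Fin n) (Fin n) ℂ →ₗ[ℂ] Matrix (Fin m) (Fin m) ℂ)
    (hΦ1 : Φ 1 = 1) (hΦpos : ∀ X : Matrix (Fin n) (Fin n) ℂ, X.PosSemidef → (Φ X).PosSemidef)
    (A : Matrix (Fin n) (Fin n) ℂ) (hA : A.PosSemidef) :
    loewnerLE (cfc f (mpow (Φ (mpow A p)) (1 / p))) ((2 * h (1 / 2)) • Φ (cfc f A)) := by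
  obtain ⟨P, hP, hP1, hPcfc⟩ := hA.isHermitian.exists_cfc_eq_sum_smul
  obtain ⟨C, hC⟩ := exists_conjTranspose_mul_diagonal_mul_eq_sum fun i ↦ hΦpos _ (hP i)
  let D : Matrix (Fin (n * m)) (Fin (n * m)) ℂ :=
    diagonal fun a ↦ (hA.isHermitian.eigenvalues (finProdFinEquiv.symm a).1 : ℂ)
  have hD : D.PosSemidef :=
    PosSemidef.diagonal fun a ↦ Complex.zero_le_real.mpr (hA.eigenvalues_nonneg _)
  have hC1 : Cᴴ * C = 1 := by
    simpa [← map_sum, hP1, hΦ1] using hC 1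
  have hΦcfc (g : ℝ → ℝ) : Φ (cfc g A) = Cᴴ * cfc g D * C := by
    rw [cfc_diagonal_ofReal, hPcfc, map_sum]
    simp_rw [map_smul]
    exact (hC fun i ↦ (g (hA.isHermitian.eigenvalues i) : ℂ)).symm
  have hres := hf.compression_le hD hC1
  rwa [← hΦcfc, mpow.eq_1 D, ← hΦcfc] at hres
end
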